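/- arXiv:1802.10469 — 2 statements merged into one kernel-verified Lean document; each statement's English description precedes it below -/
import Mathlib

section
/- For all real parameters a > 0 and 0 < b < 1, the quantity A0 = u0*(1 − b − 2*u0)/(b + u0) is strictly positive if and only if a > (b + 1)^2/(2*(1 − b)). -/
/-- For `a > 0` and `0 < b < 1`, the quantity
`A0 = u0*(1 − b − 2*u0)/(b + u0)` is strictly positive iff `a > (b+1)^2/(2*(1−b))`. -/
theorem holling_tanner_A0_pos_iff (a b : ℝ) (ha : 0 < a) (hb0 : 0 < b) (hb1 : b < 1)
    (u0 : ℝ) (hu0 : u0 = (1/2) * ((1 - a - b) + Real.sqrt ((a + b - 1)^2 + 4*b)))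
    (A0 : ℝ) (hA0 : A0 = u0 * (1 - b - 2*u0) / (b + u0)) :
    0 < A0 ↔ (b + 1)^2 / (2*(1 - b)) < a := by
  have hu : 0 < u0 := by
    have h : |a + b - 1| < Real.sqrt ((a + b - 1)^2 + 4*b) := by
      apply Real.lt_sqrt_of_sq_lt
      rw [sq_abs]
      linarith
    have h2 := le_abs_self (a + b - 1)
    rw [hu0]
    linarith
  have hs : 1 - b - 2*u0 = a - Real.sqrt ((a + b - 1)^2 + 4*b) := by
    rw [hu0]; ring
  have hden : 0 < b + u0 := by linarith
  rw [hA0, div_pos_iff_of_pos_right hden, mul_pos_iff_of_pos_left hu, hs, sub_pos,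
    Real.sqrt_lt' ha, div_lt_iff₀ (by linarith)]
  constructor <;> intro h <;> nlinarith
end

section
/- Let a, d1, d2, l > 0 and 0 < b < 1, and suppose M ∈ (0, 1] is a constant such that for every r > 0, every positive steady state (u, v) of the diffusive Holling–Tanner system on (0, lπ) satisfies M ≤ u(x) ≤ 1 and M ≤ v(x) ≤ 1 for all x ∈ [0, lπ]. If d1 ≥ l^2*(1 − 2*M − a*b*M/(b + 1)^2), then there exists R > 0 such that for every r with 0 < r ≤ R, every positive steady state (u, v) consists of constant functions; that is, the system has no non-constant positive steady state when r ≤ R. -/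
open intervalIntegral in
theorem ht_dirichlet_c (l c : ℝ) (hl : 0 < l) (hc0 : 0 < c) (hc1 : c < 1) (p p' : ℝ → ℝ)
    (hp : ∀ x, HasDerivAt p (p' x) x) (hp' : Continuous p')
    (h0 : p 0 = 0) (h1 : p (l * Real.pi) = 0) :
    c ^ 2 / l ^ 2 * ∫ x in (0:ℝ)..(l * Real.pi), p x ^ 2
      ≤ ∫ x in (0:ℝ)..(l * Real.pi), p' x ^ 2 := by
  have hpc : Continuous p := continuous_iff_continuousAt.2 fun x => (hp x).continuousAt
  have hL : 0 ≤ l * Real.pi := by positivity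
  have hpi := Real.pi_pos
  set θ : ℝ → ℝ := fun x => c * (x / l - Real.pi / 2) with hθ
  set T : ℝ → ℝ := fun x => -(c / l) * Real.tan (θ x) with hT
  have hcos : ∀ x ∈ Set.Icc 0 (l * Real.pi), 0 < Real.cos (θ x) := by
    intro x hx
    have h1 : 0 ≤ x / l := div_nonneg hx.1 hl.le
    have h2 : x / l ≤ Real.pi := by rw [div_le_iff₀ hl]; linarith [hx.2, mul_comm l Real.pi]
    apply Real.cos_pos_of_mem_Ioo
    constructor <;> simp only [hθ] <;> nlinarith
  have hTd : ∀ x ∈ Set.Icc 0 (l * Real.pi), HasDerivAt T (-(c ^ 2 / l ^ 2) - T x ^ 2) x := by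
    intro x hx
    have hne := (hcos x hx).ne'
    have hθd : HasDerivAt θ (c * (1 / l)) x :=
      (((hasDerivAt_id x).div_const l).sub_const _).const_mul c
    have : HasDerivAt T _ x := ((Real.hasDerivAt_tan hne).comp x hθd).const_mul (-(c / l))
    refine this.congr_deriv ?_
    simp only [hT, Real.tan_eq_sin_div_cos]
    have hs := Real.sin_sq_add_cos_sq (θ x)
    field_simp
    linear_combination hs
  have hTc : ContinuousOn T (Set.Icc 0 (l * Real.pi)) := fun x hx =>
    (hTd x hx).continuousAt.continuousWithinAt
  have hder : ∀ x ∈ Set.uIcc 0 (l * Real.pi), HasDerivAt (fun x => p x ^ 2 * T x)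
      (2 * p x * p' x * T x + p x ^ 2 * (-(c ^ 2 / l ^ 2) - T x ^ 2)) x := by
    intro x hx
    rw [Set.uIcc_of_le hL] at hx
    have : HasDerivAt (fun x => p x ^ 2 * T x) _ x := ((hp x).pow 2).mul (hTd x hx)
    refine this.congr_deriv ?_
    simp
  have hci : ContinuousOn (fun x => 2 * p x * p' x * T x + p x ^ 2 * (-(c ^ 2 / l ^ 2) - T x ^ 2))
      (Set.uIcc 0 (l * Real.pi)) := by
    rw [Set.uIcc_of_le hL]
    fun_prop
  have hI := integral_eq_sub_of_hasDerivAt hder hci.intervalIntegrable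
  simp only [h0, h1] at hI
  have hle : ∫ x in (0:ℝ)..(l * Real.pi),
      (2 * p x * p' x * T x + p x ^ 2 * (-(c ^ 2 / l ^ 2) - T x ^ 2))
      ≤ ∫ x in (0:ℝ)..(l * Real.pi), (p' x ^ 2 - c ^ 2 / l ^ 2 * p x ^ 2) := by
    apply integral_mono_on hL hci.intervalIntegrable
    · apply Continuous.intervalIntegrable; fun_prop
    · intro x hx
      nlinarith [sq_nonneg (p' x - p x * T x)]
  rw [integral_sub (Continuous.intervalIntegrable (by fun_prop) _ _)
    (Continuous.intervalIntegrable (by fun_prop) _ _), integral_const_mul] at hle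
  norm_num at hI
  linarith

theorem ht_dirichlet (l : ℝ) (hl : 0 < l) (p p' : ℝ → ℝ)
    (hp : ∀ x, HasDerivAt p (p' x) x) (hp' : Continuous p')
    (h0 : p 0 = 0) (h1 : p (l * Real.pi) = 0) :
    ∫ x in (0:ℝ)..(l * Real.pi), p x ^ 2
      ≤ l ^ 2 * ∫ x in (0:ℝ)..(l * Real.pi), p' x ^ 2 := by
  set A := ∫ x in (0:ℝ)..(l * Real.pi), p x ^ 2
  set B := ∫ x in (0:ℝ)..(l * Real.pi), p' x ^ 2
  have key : 1 ^ 2 / l ^ 2 * A ≤ B := by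
    have ht : Filter.Tendsto (fun c : ℝ => c ^ 2 / l ^ 2 * A) (nhdsWithin 1 (Set.Iio 1))
        (nhds (1 ^ 2 / l ^ 2 * A)) := by
      apply Filter.Tendsto.mono_left _ nhdsWithin_le_nhds
      apply Continuous.tendsto (f := fun c : ℝ => c ^ 2 / l ^ 2 * A)
      fun_prop
    apply le_of_tendsto ht
    filter_upwards [Ioo_mem_nhdsLT (show (0:ℝ) < 1 by norm_num)] with c hc
    exact ht_dirichlet_c l c hl hc.1 hc.2 p p' hp hp' h0 h1
  have hl2 : 0 < l ^ 2 := by positivity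
  have : l ^ 2 * (1 ^ 2 / l ^ 2 * A) = A := by field_simp
  nlinarith

open intervalIntegral in
theorem ht_poincare (l : ℝ) (hl : 0 < l) (z z' : ℝ → ℝ)
    (hz : ∀ x, HasDerivAt z (z' x) x) (hz' : Continuous z')
    (hmean : ∫ x in (0:ℝ)..(l * Real.pi), z x = 0) :
    ∫ x in (0:ℝ)..(l * Real.pi), z x ^ 2
      ≤ l ^ 2 * ∫ x in (0:ℝ)..(l * Real.pi), z' x ^ 2 := by
  have hzc : Continuous z := continuous_iff_continuousAt.2 fun x => (hz x).continuousAt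
  have hL : 0 ≤ l * Real.pi := by positivity
  set p : ℝ → ℝ := fun x => ∫ t in (0:ℝ)..x, z t with hpdef
  have hp : ∀ x, HasDerivAt p (z x) x := fun x => hzc.integral_hasStrictDerivAt 0 x |>.hasDerivAt
  have hpc : Continuous p := continuous_iff_continuousAt.2 fun x => (hp x).continuousAt
  have hp0 : p 0 = 0 := by simp [hpdef]
  have hp1 : p (l * Real.pi) = 0 := hmean
  have hD := ht_dirichlet l hl p z hp hzc hp0 hp1
  have hI := integral_eq_sub_of_hasDerivAt (a := 0) (b := l * Real.pi)
    (fun x _ => (hp x).mul (hz x)) (Continuous.intervalIntegrable (by fun_prop) _ _)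
  simp only [Pi.mul_apply, hp0, hp1, zero_mul, sub_zero] at hI
  have hl2 : 0 < l ^ 2 := by positivity
  have hle : ∫ x in (0:ℝ)..(l * Real.pi), (2 * l ^ 2 * (z x ^ 2))
      ≤ ∫ x in (0:ℝ)..(l * Real.pi), (2 * l ^ 2 * (z x * z x + p x * z' x)
        + (p x ^ 2 + l ^ 4 * z' x ^ 2)) := by
    apply integral_mono_on hL
    · apply Continuous.intervalIntegrable; fun_prop
    · apply Continuous.intervalIntegrable; fun_prop
    · intro x hx
      nlinarith [sq_nonneg (p x + l ^ 2 * z' x)]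
  rw [integral_add (Continuous.intervalIntegrable (by fun_prop) _ _)
    (Continuous.intervalIntegrable (by fun_prop) _ _), integral_const_mul, integral_const_mul, hI,
    integral_add (Continuous.intervalIntegrable (by fun_prop) _ _)
    (Continuous.intervalIntegrable (by fun_prop) _ _), integral_const_mul] at hle
  set A := ∫ x in (0:ℝ)..(l * Real.pi), z x ^ 2
  set B := ∫ x in (0:ℝ)..(l * Real.pi), z' x ^ 2
  have : l ^ 2 * A ≤ l ^ 2 * (l ^ 2 * B) := by nlinarith
  exact le_of_mul_le_mul_left this hl2

open intervalIntegral in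
theorem ht_mean (l : ℝ) (hl : 0 < l) (u : ℝ → ℝ) (huc : Continuous u) (M : ℝ)
    (hb : ∀ x ∈ Set.Icc 0 (l * Real.pi), M ≤ u x ∧ u x ≤ 1) :
    ∃ ub, M ≤ ub ∧ ub ≤ 1 ∧ ∫ x in (0:ℝ)..(l * Real.pi), (u x - ub) = 0 := by
  have hL : 0 < l * Real.pi := by positivity
  have h1 : ∫ x in (0:ℝ)..(l * Real.pi), M ≤ ∫ x in (0:ℝ)..(l * Real.pi), u x :=
    integral_mono_on hL.le (by simp) (huc.intervalIntegrable _ _) fun x hx => (hb x hx).1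
  have h2 : ∫ x in (0:ℝ)..(l * Real.pi), u x ≤ ∫ x in (0:ℝ)..(l * Real.pi), (1:ℝ) :=
    integral_mono_on hL.le (huc.intervalIntegrable _ _) (by simp) fun x hx => (hb x hx).2
  simp only [integral_const, sub_zero, smul_eq_mul] at h1 h2
  refine ⟨(∫ x in (0:ℝ)..(l * Real.pi), u x) / (l * Real.pi), ?_, ?_, ?_⟩
  · rw [le_div_iff₀ hL]; linarith
  · rw [div_le_iff₀ hL]; linarith
  · rw [integral_sub (huc.intervalIntegrable _ _) (by simp)]
    simp only [integral_const, sub_zero, smul_eq_mul]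
    field_simp
    simp

open intervalIntegral in
theorem ht_energy (l d ub c : ℝ) (hl : 0 < l) (hd : 0 < d) (u F h : ℝ → ℝ) (hu : ContDiff ℝ 2 u)
    (hmean : ∫ x in (0:ℝ)..(l * Real.pi), (u x - ub) = 0)
    (heq : ∀ x ∈ Set.Icc 0 (l * Real.pi), d * deriv (deriv u) x + F x = 0)
    (h0 : deriv u 0 = 0) (h1 : deriv u (l * Real.pi) = 0) (hh : Continuous h)
    (hle : ∀ x ∈ Set.Icc 0 (l * Real.pi), (F x - c) * (u x - ub) ≤ h x) :
    d / l ^ 2 * ∫ x in (0:ℝ)..(l * Real.pi), (u x - ub) ^ 2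
      ≤ ∫ x in (0:ℝ)..(l * Real.pi), h x := by
  have hL : 0 < l * Real.pi := by positivity
  have hu1 : ContDiff ℝ 1 (deriv u) := ((contDiff_succ_iff_deriv (n := 1)).1 hu).2.2
  have hud : ∀ x, HasDerivAt u (deriv u x) x := fun x =>
    (hu.differentiable (by norm_num) x).hasDerivAt
  have hudd : ∀ x, HasDerivAt (deriv u) (deriv (deriv u) x) x := fun x =>
    (hu1.differentiable (by norm_num) x).hasDerivAt
  have huc : Continuous u := hu.continuous
  have hu'c : Continuous (deriv u) := hu1.continuous
  have hu''c : Continuous (deriv (deriv u)) := hu1.continuous_deriv (by norm_num)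
  have hP := ht_poincare l hl (fun x => u x - ub) (deriv u)
    (fun x => (hud x).sub_const ub) hu'c hmean
  have hI := integral_eq_sub_of_hasDerivAt (a := 0) (b := l * Real.pi)
    (fun x _ => (hudd x).mul ((hud x).sub_const ub))
    (Continuous.intervalIntegrable (by fun_prop) _ _)
  simp only [Pi.mul_apply, h0, h1, zero_mul, sub_zero] at hI
  have hm : ∫ x in (0:ℝ)..(l * Real.pi),
      (d * (deriv u x ^ 2) - d * (deriv (deriv u) x * (u x - ub) + deriv u x * deriv u x)
        - c * (u x - ub))
      ≤ ∫ x in (0:ℝ)..(l * Real.pi), h x := by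
    apply integral_mono_on hL.le
    · apply Continuous.intervalIntegrable; fun_prop
    · exact hh.intervalIntegrable _ _
    · intro x hx
      have e := heq x hx
      have e2 := hle x hx
      have : F x = - (d * deriv (deriv u) x) := by linarith
      rw [this] at e2
      linarith
  rw [integral_sub (Continuous.intervalIntegrable (by fun_prop) _ _)
    (Continuous.intervalIntegrable (by fun_prop) _ _),
    integral_sub (Continuous.intervalIntegrable (by fun_prop) _ _)
    (Continuous.intervalIntegrable (by fun_prop) _ _), integral_const_mul, integral_const_mul,
    integral_const_mul, hI, hmean] at hm
  have hl2 : 0 < l ^ 2 := by positivity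
  have h3 := mul_le_mul_of_nonneg_left hP (by positivity : 0 ≤ d / l ^ 2)
  have : d / l ^ 2 * (l ^ 2 * ∫ x in (0:ℝ)..(l * Real.pi), deriv u x ^ 2)
    = d * ∫ x in (0:ℝ)..(l * Real.pi), deriv u x ^ 2 := by field_simp
  linarith

theorem ht_const (l ub : ℝ) (hl : 0 < l) (u : ℝ → ℝ) (huc : Continuous u)
    (h : ∫ x in (0:ℝ)..(l * Real.pi), (u x - ub) ^ 2 ≤ 0) :
    ∀ x ∈ Set.Icc 0 (l * Real.pi), u x = ub := by
  by_contra! hcon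
  obtain ⟨x, hx, hne⟩ := hcon
  have hL : 0 < l * Real.pi := by positivity
  have := intervalIntegral.integral_pos (f := fun x => (u x - ub) ^ 2) hL
    (by fun_prop) (fun x _ => sq_nonneg _) ⟨x, hx, by
      have : u x - ub ≠ 0 := sub_ne_zero.2 hne
      positivity⟩
  linarith

/-- pointwise estimate for the prey equation -/
theorem ht_pointwise_u (a b M δ U V Ub Vb : ℝ) (ha : 0 < a) (hb : 0 < b) (hM0 : 0 < M)
    (hδ0 : 0 < δ) (hδ1 : δ ≤ 1 - M) (hδ2 : δ ≤ a * b * M / (b + 1) ^ 3 * (1 - M))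
    (hconv : ∀ t, M ≤ t → t ≤ 1 → δ ≤ (t - M) + a * b * M / (b + 1) ^ 3 * (1 - t))
    (hU : M ≤ U) (hU1 : U ≤ 1) (hV : M ≤ V) (hUb : M ≤ Ub) (hUb1 : Ub ≤ 1) :
    (U * (1 - U) - a * U * V / (U + b) - (Ub * (1 - Ub) - a * Ub * Vb / (Ub + b))) * (U - Ub)
      ≤ (1 - 2*M - a*b*M/(b + 1)^2 - δ / 2) * (U - Ub) ^ 2
        + a ^ 2 / (2 * δ) * (V - Vb) ^ 2 := by
  have hs : 0 < U + b := by linarith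
  have ht : 0 < Ub + b := by linarith
  have hb1 : 0 < b + 1 := by linarith
  have e : (U * (1 - U) - a * U * V / (U + b) - (Ub * (1 - Ub) - a * Ub * Vb / (Ub + b)))
      * (U - Ub) = (1 - U - Ub - a * b * V / ((U + b) * (Ub + b))) * (U - Ub) ^ 2
        - (Ub / (Ub + b)) * (a * (V - Vb) * (U - Ub)) := by
    field_simp
    ring
  have h1 : a * b * M / (b + 1) ^ 2 + a * b * M / (b + 1) ^ 3 * (1 - Ub)
      ≤ a * b * V / ((U + b) * (Ub + b)) := by
    calc _ = a * b * M * ((b + 1 + (1 - Ub)) / (b + 1) ^ 3) := by field_simp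
      _ ≤ a * b * M * (1 / ((b + 1) * (Ub + b))) := by
          apply mul_le_mul_of_nonneg_left _ (by positivity)
          rw [div_le_div_iff₀ (by positivity) (by positivity)]
          have : (b + 1 + (1 - Ub)) * (Ub + b) ≤ (b + 1) ^ 2 := by nlinarith [sq_nonneg (1 - Ub)]
          nlinarith
      _ = a * b * M / ((b + 1) * (Ub + b)) := by ring
      _ ≤ a * b * V / ((U + b) * (Ub + b)) := by
          apply div_le_div₀
          · have : 0 < V := by linarith
            positivity
          · gcongr
          · positivity
          · gcongr ?_ * _
            linarith
  have h2 := hconv Ub hUb hUb1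
  have h3 : 1 - U - Ub - a * b * V / ((U + b) * (Ub + b))
      ≤ 1 - 2*M - a*b*M/(b + 1)^2 - δ := by linarith
  have h4 := mul_le_mul_of_nonneg_right h3 (sq_nonneg (U - Ub))
  have hq0 : 0 ≤ Ub / (Ub + b) := div_nonneg (by linarith) ht.le
  have hq1 : Ub / (Ub + b) ≤ 1 := by rw [div_le_one ht]; linarith
  set q := Ub / (Ub + b)
  have h5 : -(q * (a * (V - Vb) * (U - Ub))) ≤ δ / 2 * (U - Ub) ^ 2
      + a ^ 2 / (2 * δ) * (V - Vb) ^ 2 := by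
    have : δ / 2 * (U - Ub) ^ 2 + a ^ 2 / (2 * δ) * (V - Vb) ^ 2
      + (q * (a * (V - Vb) * (U - Ub)))
      = ((δ * (U - Ub) + q * (a * (V - Vb))) ^ 2 + (1 - q ^ 2) * (a * (V - Vb)) ^ 2)
        / (2 * δ) := by
      field_simp
      ring
    have h6 : 0 ≤ 1 - q ^ 2 := by nlinarith
    have : 0 ≤ ((δ * (U - Ub) + q * (a * (V - Vb))) ^ 2 + (1 - q ^ 2) * (a * (V - Vb)) ^ 2)
        / (2 * δ) := by positivity
    linarith
  rw [e]
  linarith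

/-- pointwise estimate for the predator equation -/
theorem ht_pointwise_v (M r U V Ub Vb : ℝ) (hM0 : 0 < M) (hr : 0 < r)
    (hU : M ≤ U) (hUb : M ≤ Ub) (hV : M ≤ V) (hVb : M ≤ Vb) (hVb1 : Vb ≤ 1) :
    (r * V * (1 - V / U) - r * Vb * (1 - Vb / Ub)) * (V - Vb)
      ≤ r * ((1 + 1 / (2 * M ^ 2)) * (V - Vb) ^ 2 + 1 / (2 * M ^ 2) * (U - Ub) ^ 2) := by
  have hU0 : 0 < U := by linarith
  have hUb0 : 0 < Ub := by linarith
  have e : (r * V * (1 - V / U) - r * Vb * (1 - Vb / Ub)) * (V - Vb)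
    = r * ((1 - (V + Vb) / U) * (V - Vb) ^ 2
      + Vb ^ 2 / (U * Ub) * ((U - Ub) * (V - Vb))) := by
    field_simp
    ring
  rw [e]
  apply mul_le_mul_of_nonneg_left _ hr.le
  have h1 : 0 ≤ (V + Vb) / U := div_nonneg (by linarith) hU0.le
  have hq0 : 0 ≤ Vb ^ 2 / (U * Ub) := by positivity
  have hq1 : Vb ^ 2 / (U * Ub) ≤ 1 / M ^ 2 := by
    apply div_le_div₀ (by norm_num) _ (by positivity) (by nlinarith)
    nlinarith
  have e2 : 1 / (2 * M ^ 2) = (1 / M ^ 2) / 2 := by field_simp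
  rw [e2]
  set q := Vb ^ 2 / (U * Ub)
  set m := 1 / M ^ 2
  have h2 := mul_nonneg h1 (sq_nonneg (V - Vb))
  have h3 := mul_nonneg hq0 (sq_nonneg ((U - Ub) - (V - Vb)))
  have h4 := mul_le_mul_of_nonneg_right hq1
    (add_nonneg (sq_nonneg (U - Ub)) (sq_nonneg (V - Vb)))
  nlinarith

/-- A positive steady state of the diffusive Holling–Tanner system on `(0, lπ)`:
twice continuously differentiable positive functions `u, v` on `[0, lπ]` solving
`d1 u'' + u(1−u) − a u v/(u+b) = 0`, `d2 v'' + r v(1 − v/u) = 0` with Neumann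
boundary conditions. -/
def IsPositiveSteadyState (a b d1 d2 r l : ℝ) (u v : ℝ → ℝ) : Prop :=
  ContDiff ℝ 2 u ∧ ContDiff ℝ 2 v ∧
  (∀ x ∈ Set.Icc 0 (l * Real.pi), 0 < u x) ∧
  (∀ x ∈ Set.Icc 0 (l * Real.pi), 0 < v x) ∧
  (∀ x ∈ Set.Icc 0 (l * Real.pi),
    d1 * deriv (deriv u) x + u x * (1 - u x) - a * u x * v x / (u x + b) = 0) ∧
  (∀ x ∈ Set.Icc 0 (l * Real.pi),
    d2 * deriv (deriv v) x + r * v x * (1 - v x / u x) = 0) ∧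
  deriv u 0 = 0 ∧ deriv u (l * Real.pi) = 0 ∧
  deriv v 0 = 0 ∧ deriv v (l * Real.pi) = 0

/-- Let `a, d1, d2, l > 0`, `0 < b < 1`, and suppose `M ∈ (0, 1]` is
such that for every `r > 0`, every positive steady state `(u, v)` satisfies
`M ≤ u ≤ 1` and `M ≤ v ≤ 1` on `[0, lπ]`. If `d1 ≥ l²(1 − 2M − abM/(b+1)²)`, then
there is `R > 0` such that for every `0 < r ≤ R`, every positive steady state
consists of constant functions. -/
theorem holling_tanner_no_nonconstant_steady_state
    (a b d1 d2 l M : ℝ) (ha : 0 < a) (hb0 : 0 < b) (hb1 : b < 1)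
    (hd1 : 0 < d1) (hd2 : 0 < d2) (hl : 0 < l)
    (hM0 : 0 < M) (hM1 : M ≤ 1)
    (hM : ∀ r : ℝ, 0 < r →
      ∀ u v : ℝ → ℝ, IsPositiveSteadyState a b d1 d2 r l u v →
        ∀ x ∈ Set.Icc 0 (l * Real.pi),
          M ≤ u x ∧ u x ≤ 1 ∧ M ≤ v x ∧ v x ≤ 1)
    (hd1big : l^2 * (1 - 2*M - a*b*M/(b + 1)^2) ≤ d1) :
    ∃ R : ℝ, 0 < R ∧
      ∀ r : ℝ, 0 < r → r ≤ R →
        ∀ u v : ℝ → ℝ, IsPositiveSteadyState a b d1 d2 r l u v →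
          ∀ x ∈ Set.Icc 0 (l * Real.pi), ∀ y ∈ Set.Icc 0 (l * Real.pi),
            u x = u y ∧ v x = v y := by
  have hL : 0 < l * Real.pi := by positivity
  rcases hM1.lt_or_eq with hM1' | hM1'
  swap
  · refine ⟨1, one_pos, fun r hr _ u v huv x hx y hy => ?_⟩
    have h1 := hM r hr u v huv x hx
    have h2 := hM r hr u v huv y hy
    constructor <;> linarith
  set k := a * b * M / (b + 1) ^ 3 with hk
  have hk0 : 0 < k := by positivity
  set δ := min 1 k * (1 - M) with hδ
  have hδ0 : 0 < δ := mul_pos (lt_min one_pos hk0) (by linarith)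
  have hm1 : min 1 k ≤ 1 := min_le_left _ _
  have hm2 : min 1 k ≤ k := min_le_right _ _
  have hδ1 : δ ≤ 1 - M := by nlinarith
  have hδ2 : δ ≤ k * (1 - M) := by nlinarith
  have hconv : ∀ t, M ≤ t → t ≤ 1 → δ ≤ (t - M) + k * (1 - t) := by
    intro t h1 h2
    nlinarith
  set C := 1 + 1 / (2 * M ^ 2) + 1 / (2 * M ^ 2) * (a ^ 2 / δ ^ 2) with hC
  have hC0 : 0 < C := by positivity
  refine ⟨d2 / l ^ 2 / (2 * C), by positivity, fun r hr hrR u v huv => ?_⟩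
  have hbd := hM r hr u v huv
  obtain ⟨hu, hv, -, -, hequ, heqv, hu0, hu1, hv0, hv1⟩ := huv
  have huc := hu.continuous
  have hvc := hv.continuous
  obtain ⟨ub, hub, hub1, hum⟩ := ht_mean l hl u huc M fun x hx => ⟨(hbd x hx).1, (hbd x hx).2.1⟩
  obtain ⟨vb, hvb, hvb1, hvm⟩ := ht_mean l hl v hvc M fun x hx =>
    ⟨(hbd x hx).2.2.1, (hbd x hx).2.2.2⟩
  have E1 := ht_energy l d1 ub (ub * (1 - ub) - a * ub * vb / (ub + b)) hl hd1 u
    (fun x => u x * (1 - u x) - a * u x * v x / (u x + b))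
    (fun x => (1 - 2*M - a*b*M/(b + 1)^2 - δ / 2) * (u x - ub) ^ 2
        + a ^ 2 / (2 * δ) * (v x - vb) ^ 2) hu hum
    (fun x hx => by have := hequ x hx; linarith) hu0 hu1 (by fun_prop)
    (fun x hx => ht_pointwise_u a b M δ (u x) (v x) ub vb ha hb0 hM0 hδ0 hδ1 hδ2 hconv
      (hbd x hx).1 (hbd x hx).2.1 (hbd x hx).2.2.1 hub hub1)
  have E2 := ht_energy l d2 vb (r * vb * (1 - vb / ub)) hl hd2 v
    (fun x => r * v x * (1 - v x / u x))
    (fun x => r * ((1 + 1 / (2 * M ^ 2)) * (v x - vb) ^ 2 + 1 / (2 * M ^ 2) * (u x - ub) ^ 2))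
    hv hvm heqv hv0 hv1 (by fun_prop)
    (fun x hx => ht_pointwise_v M r (u x) (v x) ub vb hM0 hr
      (hbd x hx).1 hub (hbd x hx).2.2.1 hvb hvb1)
  rw [intervalIntegral.integral_add (Continuous.intervalIntegrable (by fun_prop) _ _)
    (Continuous.intervalIntegrable (by fun_prop) _ _), intervalIntegral.integral_const_mul,
    intervalIntegral.integral_const_mul] at E1
  rw [intervalIntegral.integral_const_mul,
    intervalIntegral.integral_add (Continuous.intervalIntegrable (by fun_prop) _ _)
    (Continuous.intervalIntegrable (by fun_prop) _ _), intervalIntegral.integral_const_mul,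
    intervalIntegral.integral_const_mul] at E2
  have hcu := ht_const l ub hl u huc
  have hcv := ht_const l vb hl v hvc
  have hZ0 : 0 ≤ ∫ x in (0:ℝ)..(l * Real.pi), (u x - ub) ^ 2 :=
    intervalIntegral.integral_nonneg hL.le fun x _ => sq_nonneg _
  have hW0 : 0 ≤ ∫ x in (0:ℝ)..(l * Real.pi), (v x - vb) ^ 2 :=
    intervalIntegral.integral_nonneg hL.le fun x _ => sq_nonneg _
  set Z := ∫ x in (0:ℝ)..(l * Real.pi), (u x - ub) ^ 2
  set W := ∫ x in (0:ℝ)..(l * Real.pi), (v x - vb) ^ 2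
  have hK : 1 - 2*M - a*b*M/(b + 1)^2 ≤ d1 / l ^ 2 := by
    rw [le_div_iff₀ (by positivity)]; linarith
  have hK' := mul_le_mul_of_nonneg_right hK hZ0
  have hZW : Z ≤ a ^ 2 / δ ^ 2 * W := by
    have h1 : δ / 2 * Z ≤ a ^ 2 / (2 * δ) * W := by linarith
    have h2 : a ^ 2 / (2 * δ) * W = δ / 2 * (a ^ 2 / δ ^ 2 * W) := by field_simp
    rw [h2] at h1
    exact le_of_mul_le_mul_left h1 (by positivity)
  have hW : W ≤ 0 := by
    have h1 : (1 + 1 / (2 * M ^ 2)) * W + 1 / (2 * M ^ 2) * Z ≤ C * W := by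
      have := mul_le_mul_of_nonneg_left hZW (by positivity : 0 ≤ 1 / (2 * M ^ 2))
      rw [hC]
      linarith
    have h2 : r * ((1 + 1 / (2 * M ^ 2)) * W + 1 / (2 * M ^ 2) * Z)
        ≤ d2 / l ^ 2 / (2 * C) * (C * W) :=
      (mul_le_mul_of_nonneg_left h1 hr.le).trans
        (mul_le_mul_of_nonneg_right hrR (mul_nonneg hC0.le hW0))
    have h3 : d2 / l ^ 2 / (2 * C) * (C * W) = d2 / l ^ 2 * (W / 2) := by field_simp
    have h4 : d2 / l ^ 2 * W ≤ d2 / l ^ 2 * (W / 2) := by linarith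
    have := le_of_mul_le_mul_left h4 (by positivity)
    linarith
  have hW' : W = 0 := le_antisymm hW hW0
  have hZ : Z ≤ 0 := by rw [hW'] at hZW; linarith
  intro x hx y hy
  exact ⟨(hcu hZ x hx).trans (hcu hZ y hy).symm, (hcv hW x hx).trans (hcv hW y hy).symm⟩
end
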